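/- arXiv:2505.18704 — 2 statements merged into one kernel-verified Lean document; each statement's English description precedes it below -/
import Mathlib

section
/- The product of two countable crowded Hausdorff topological spaces is $\omega$-resolvable (in fact maximally resolvable): it can be partitioned into countably infinitely many pairwise disjoint dense subsets. -/
open Set

/-- In a Hausdorff space, two points of a dense-in-itself set `C` can be separated by a partition
of `C` into two dense-in-themselves sets. -/
theorem Preperfect.exists_split {X : Type*} [TopologicalSpace X] [T2Space X] {C : Set X}
    (hC : Preperfect C) {x y : X} (hx : x ∈ C) (hxy : x ≠ y) :
    ∃ A ⊆ C, x ∈ A ∧ y ∉ A ∧ Preperfect A ∧ Preperfect (C \ A) := by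
  obtain ⟨U, V, hU, hV, hxU, hyV, hUV⟩ := t2_separation hxy
  have hCU : Preperfect (U ∩ C) := hC.open_inter hU
  refine ⟨C ∩ closure (U ∩ C), inter_subset_left, ⟨hx, subset_closure ⟨hxU, hx⟩⟩, ?_, ?_, ?_⟩
  · rintro ⟨-, hy⟩
    obtain ⟨z, hzV, hzU, -⟩ := mem_closure_iff.1 hy V hV hyV
    exact disjoint_left.1 hUV hzU hzV
  · rintro z ⟨-, hz⟩
    have hsub : U ∩ C ⊆ C ∩ closure (U ∩ C) := fun w hw => ⟨hw.2, subset_closure hw⟩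
    refine AccPt.mono (?_ : AccPt z (Filter.principal (U ∩ C))) (Filter.principal_mono.2 hsub)
    by_cases h : z ∈ U ∩ C
    · exact hCU z h
    · rw [accPt_principal_iff_clusterPt, sdiff_singleton_eq_self h]
      exact mem_closure_iff_clusterPt.1 hz
  · have h : C \ (C ∩ closure (U ∩ C)) = (closure (U ∩ C))ᶜ ∩ C := by
      ext z
      simp only [mem_sdiff, mem_inter_iff, mem_compl_iff]
      tauto
    rw [h]
    exact hC.open_inter isClosed_closure.isOpen_compl

/-- An equivalence relation with dense-in-themselves classes can be refined to one that separates
two given points. -/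
theorem Setoid.exists_le_preperfect {X : Type*} [TopologicalSpace X] [T2Space X] (r : Setoid X)
    (hr : ∀ a, Preperfect {z | r z a}) (x y : X) :
    ∃ s ≤ r, (∀ a, Preperfect {z | s z a}) ∧ (x ≠ y → ¬ s x y) := by
  by_cases hxy : x ≠ y
  swap
  · exact ⟨r, le_rfl, hr, fun h => absurd h hxy⟩
  obtain ⟨A, hAC, hxA, hyA, hA, hCA⟩ := (hr x).exists_split (r.refl x) hxy
  have hs : ∀ u v, (r ⊓ Setoid.ker (· ∈ A)) u v ↔ r u v ∧ (u ∈ A ↔ v ∈ A) := fun u v => by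
    rw [Setoid.inf_def]
    simp [Setoid.ker_def]
  refine ⟨r ⊓ Setoid.ker (· ∈ A), inf_le_left, fun a => ?_, fun _ h => ?_⟩
  · simp only [hs]
    by_cases haA : a ∈ A
    · convert hA using 1
      ext z
      simp only [mem_ofPred_eq, haA, iff_true]
      exact ⟨And.right, fun hz => ⟨r.trans (hAC hz) (r.symm (hAC haA)), hz⟩⟩
    · by_cases hax : r a x
      · convert hCA using 1
        ext z
        simp only [mem_ofPred_eq, haA, iff_false, mem_sdiff]
        exact and_congr_left fun _ =>
          ⟨fun h => r.trans h hax, fun h => r.trans h (r.symm hax)⟩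
      · convert hr a using 1
        ext z
        simp only [mem_ofPred_eq, haA, iff_false, and_iff_left_iff_imp]
        exact fun hz hzA => hax (r.trans (r.symm hz) (hAC hzA))
  · exact hyA (((hs x y).1 h).2.1 hxA)

/-- A countable crowded Hausdorff space carries a decreasing sequence of equivalence relations with
dense-in-themselves classes which together separate points. -/
theorem exists_antitone_setoid_preperfect (X : Type*) [TopologicalSpace X] [T2Space X]
    [Countable X] (hX : Preperfect (univ : Set X)) :
    ∃ r : ℕ → Setoid X, Antitone r ∧ (∀ k a, Preperfect {z | r k z a}) ∧
      ∀ x y, x ≠ y → ∃ k, ¬ r k x y := by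
  rcases isEmpty_or_nonempty X with hE | hE
  · exact ⟨fun _ => ⊤, antitone_const, fun _ a => (hE.false a).elim, fun x => (hE.false x).elim⟩
  obtain ⟨p, hp⟩ := exists_surjective_nat (X × X)
  choose f hle hf hsep using fun (r : {r : Setoid X // ∀ a, Preperfect {z | r z a}}) (q : X × X) =>
    Setoid.exists_le_preperfect r.1 r.2 q.1 q.2
  let R : ℕ → {r : Setoid X // ∀ a, Preperfect {z | r z a}} := fun n =>
    Nat.rec ⟨⊤, fun _ => by simpa [Setoid.top_def] using hX⟩
      (fun k r => ⟨f r (p k), hf r (p k)⟩) n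
  refine ⟨fun n => (R n).1, antitone_nat_of_succ_le fun n => hle (R n) (p n),
    fun k => (R k).2, fun x y hxy => ?_⟩
  obtain ⟨k, hk⟩ := hp (x, y)
  refine ⟨k + 1, ?_⟩
  have h := hsep (R k) (p k)
  rw [hk] at h
  change ¬ (f (R k) (p k)) x y
  rw [hk]
  exact h hxy

/-- A countable crowded Hausdorff space carries a labelling of its points by finite sets of naturals
for which every point is a limit of points whose labels are proper end-extensions of its own,
starting arbitrarily far. -/
theorem exists_finset_labelling (X : Type*) [TopologicalSpace X] [T2Space X]
    [Countable X] (hX : Preperfect (univ : Set X)) :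
    ∃ F : X → Finset ℕ, ∀ (a : X) (U : Set X), IsOpen U → a ∈ U → ∀ N : ℕ,
      ∃ b ∈ U, F a ⊂ F b ∧ ∀ k ∈ F b, k ∉ F a → N < k := by
  obtain ⟨r, hanti, hperf, hsep⟩ := exists_antitone_setoid_preperfect X hX
  obtain ⟨e, he⟩ := Countable.exists_injective_nat X
  have hmono : ∀ {i j : ℕ} {x y : X}, i ≤ j → r j x y → r i x y := fun h hxy => hanti h hxy
  have hK : ∀ a, ∃ K, ∀ w, r K w a → e w ≤ e a → w = a := by
    intro a
    have hfin : {w | e w ≤ e a}.Finite := (finite_Iic (e a)).preimage he.injOn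
    have hex : ∀ w, ∃ k, r k w a → w = a := fun w => by
      by_cases h : w = a
      · exact ⟨0, fun _ => h⟩
      · obtain ⟨k, hk⟩ := hsep w a h
        exact ⟨k, fun h => absurd h hk⟩
    choose κ hκ using hex
    obtain ⟨K, hK⟩ := (hfin.image κ).bddAbove
    exact ⟨K, fun w hw hwa => hκ w (hmono (hK (mem_image_of_mem κ hwa)) hw)⟩
  choose K hK using hK
  let S : X → Set ℕ := fun a => {k | ∃ z, r k z a ∧ ¬ r (k + 1) z a ∧ ∀ w, r k w a → e z ≤ e w}
  have hSK : ∀ a, ∀ k ∈ S a, k < K a := by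
    rintro a k ⟨z, hz, hz', hmin⟩
    by_contra! hk
    rw [hK a z (hmono hk hz) (hmin a ((r k).refl a))] at hz'
    exact hz' ((r (k + 1)).refl a)
  have hSfin : ∀ a, (S a).Finite := fun a => (finite_Iio (K a)).subset (hSK a)
  have hScongr : ∀ {M k : ℕ} {a b : X}, r M a b → k < M → k ∈ S a → k ∈ S b := by
    rintro M k a b hab hk ⟨z, hz, hz', hmin⟩
    have h0 : r k a b := hmono hk.le hab
    have h1 : r (k + 1) a b := hmono hk hab
    exact ⟨z, (r k).trans hz h0, fun h => hz' ((r (k + 1)).trans h ((r (k + 1)).symm h1)),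
      fun w hw => hmin w ((r k).trans hw ((r k).symm h0))⟩
  refine ⟨fun a => (hSfin a).toFinset, fun a U hU haU N => ?_⟩
  set M := max (K a) (N + 1)
  obtain ⟨b, ⟨hbU, hba⟩, hne⟩ :=
    accPt_iff_nhds.1 (hperf M a a ((r M).refl a)) U (hU.mem_nhds haU)
  have hab : r M a b := (r M).symm hba
  have hsub : S a ⊆ S b := fun k hk => hScongr hab ((hSK a k hk).trans_le (le_max_left _ _)) hk
  have hnew : ∀ k ∈ S b, k ∉ S a → M ≤ k := fun k hk hk' => by
    by_contra! hlt
    exact hk' (hScongr hba hlt hk)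
  refine ⟨b, hbU, ?_, fun k hk hk' => ?_⟩
  · rw [Set.Finite.toFinset_ssubset_toFinset]
    refine hsub.ssubset_of_ne fun heq => ?_
    classical
    have hex := hsep a b (Ne.symm hne)
    set m := Nat.find hex
    have hmn : ¬ r m a b := Nat.find_spec hex
    have hMm : M < m := by
      by_contra! h
      exact hmn (hmono h hab)
    obtain ⟨k, hk⟩ : ∃ k, m = k + 1 := ⟨m - 1, by omega⟩
    have hkr : r k a b := by
      by_contra h
      have := Nat.find_min' hex h
      omega
    have hkS : k ∈ S b := by
      refine ⟨a, hkr, hk ▸ hmn, fun w hw => ?_⟩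
      by_contra! hlt
      have hwa : r (K a) w a := hmono (by omega) ((r k).trans hw ((r k).symm hkr))
      rw [hK a w hwa hlt.le] at hlt
      exact lt_irrefl _ hlt
    have := hSK a k (heq ▸ hkS)
    omega
  · have := hnew k (by simpa using hk) (by simpa using hk')
    omega

/-- The number of passages from `t` to `s` in the increasing enumeration of `s ∪ t`. -/
def Finset.oscillation (s t : Finset ℕ) : ℕ :=
  (s.filter fun k => ∃ l ∈ t, l < k ∧ ∀ j ∈ s, j < k → j < l).card

theorem Finset.oscillation_extend_right {s t t' : Finset ℕ} (htt : t ⊆ t')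
    (hnew : ∀ l ∈ t', l ∉ t → ∀ k ∈ s, k < l) : s.oscillation t' = s.oscillation t := by
  unfold Finset.oscillation
  congr 1
  refine Finset.filter_congr fun k hk => ⟨?_, ?_⟩
  · rintro ⟨l, hl, hlk, h⟩
    refine ⟨l, ?_, hlk, h⟩
    by_contra hlt
    exact lt_asymm hlk (hnew l hl hlt k hk)
  · rintro ⟨l, hl, h⟩
    exact ⟨l, htt hl, h⟩

theorem Finset.oscillation_extend_left {s s' t : Finset ℕ} (hss : s ⊂ s')
    (hnew : ∀ k ∈ s', k ∉ s → (∀ j ∈ s, j < k) ∧ ∀ l ∈ t, l < k)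
    (htop : ∃ l ∈ t, ∀ j ∈ s, j < l) : s'.oscillation t = s.oscillation t + 1 := by
  have hne : (s' \ s).Nonempty := Finset.sdiff_nonempty.2 hss.2
  set m := (s' \ s).min' hne
  obtain ⟨hms', hms⟩ := Finset.mem_sdiff.1 ((s' \ s).min'_mem hne)
  have hmin : ∀ k ∈ s', k ∉ s → m ≤ k := fun k hk hk' =>
    (s' \ s).min'_le k (Finset.mem_sdiff.2 ⟨hk, hk'⟩)
  unfold Finset.oscillation
  rw [← Finset.card_insert_of_notMem (a := m) (fun h => hms (Finset.mem_filter.1 h).1)]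
  congr 1
  ext k
  simp only [Finset.mem_filter, Finset.mem_insert]
  constructor
  · rintro ⟨hk, l, hl, hlk, h⟩
    by_cases hks : k ∈ s
    · exact Or.inr ⟨hks, l, hl, hlk, fun j hj => h j (hss.1 hj)⟩
    · left
      by_contra hkm
      have h1 : m < l := h m hms' (lt_of_le_of_ne (hmin k hk hks) (Ne.symm hkm))
      exact lt_asymm h1 ((hnew m hms' hms).2 l hl)
  · rintro (rfl | ⟨hk, l, hl, hlk, h⟩)
    · obtain ⟨l, hl, hls⟩ := htop
      refine ⟨hms', l, hl, (hnew _ hms' hms).2 l hl, fun j hj hjm => hls j ?_⟩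
      by_contra hjs
      exact absurd (hmin j hj hjs) (not_le.2 hjm)
    · refine ⟨hss.1 hk, l, hl, hlk, fun j hj hjk => h j ?_ hjk⟩
      by_contra hjs
      exact lt_asymm hjk ((hnew j hj hjs).1 k hk)

/-- The product of two countable crowded Hausdorff spaces can be
partitioned into countably infinitely many pairwise disjoint dense subsets. -/
theorem stmt3 (X Y : Type*) [TopologicalSpace X] [TopologicalSpace Y]
    [Countable X] [Countable Y] [T2Space X] [T2Space Y]
    (hX : ∀ x : X, Filter.NeBot (nhdsWithin x {x}ᶜ))
    (hY : ∀ y : Y, Filter.NeBot (nhdsWithin y {y}ᶜ)) :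
    ∃ D : ℕ → Set (X × Y),
      (⋃ n, D n) = Set.univ ∧
      Pairwise (Function.onFun Disjoint D) ∧
      ∀ n, Dense (D n) := by
  obtain ⟨F, hF⟩ := exists_finset_labelling X fun x _ => by
    simpa [AccPt] using hX x
  obtain ⟨G, hG⟩ := exists_finset_labelling Y fun y _ => by
    simpa [AccPt] using hY y
  refine ⟨fun n => {q | (Nat.unpair ((F q.1).oscillation (G q.2))).1 = n}, ?_, ?_, fun n => ?_⟩
  · exact eq_univ_of_forall fun q => mem_iUnion.2 ⟨_, rfl⟩
  · exact fun i j hij => disjoint_left.2 fun q hi hj => hij (hi.symm.trans hj)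
  rintro ⟨x, y⟩
  rw [mem_closure_iff]
  intro W hW hxyW
  obtain ⟨U, V, hU, hV, hxU, hyV, hUV⟩ := isOpen_prod_iff.1 hW x y hxyW
  have hextend : ∀ (s : Finset ℕ), ∀ b ∈ V, ∃ b' ∈ V, G b ⊆ G b' ∧
      (∀ l ∈ G b', l ∉ G b → ∀ k ∈ s, k < l) ∧ ∃ l ∈ G b', ∀ j ∈ s, j < l := by
    intro s b hb
    obtain ⟨b', hb', hss, hnew⟩ := hG b V hV hb (s.sup id)
    have hlt : ∀ l ∈ G b', l ∉ G b → ∀ k ∈ s, k < l := fun l hl hl' k hk =>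
      (Finset.le_sup (f := id) hk).trans_lt (hnew l hl hl')
    obtain ⟨l, hl, hl'⟩ := Finset.exists_of_ssubset hss
    exact ⟨b', hb', hss.1, hlt, l, hl, hlt l hl hl'⟩
  obtain ⟨y₀, hy₀, -, -, hy₀top⟩ := hextend (F x) y hyV
  have key : ∀ i, ∃ a ∈ U, ∃ b ∈ V, (F a).oscillation (G b) = (F x).oscillation (G y₀) + i ∧
      ∃ l ∈ G b, ∀ j ∈ F a, j < l := by
    intro i
    induction i with
    | zero => exact ⟨x, hxU, y₀, hy₀, rfl, hy₀top⟩
    | succ i ih =>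
      obtain ⟨a, ha, b, hb, hosc, htop⟩ := ih
      obtain ⟨a', ha', hss, hnew⟩ := hF a U hU ha ((F a ∪ G b).sup id)
      obtain ⟨b', hb', hsub, hnew', htop'⟩ := hextend (F a') b hb
      refine ⟨a', ha', b', hb', ?_, htop'⟩
      rw [Finset.oscillation_extend_right hsub hnew',
        Finset.oscillation_extend_left hss (fun k hk hk' => ?_) htop, hosc, add_assoc]
      have hlt : ∀ j ∈ F a ∪ G b, j < k := fun j hj =>
        (Finset.le_sup (f := id) hj).trans_lt (hnew k hk hk')
      exact ⟨fun j hj => hlt j (Finset.mem_union_left _ hj),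
        fun l hl => hlt l (Finset.mem_union_right _ hl)⟩
  obtain ⟨i, hi⟩ := Nat.exists_eq_add_of_le
    (Nat.right_le_pair n ((F x).oscillation (G y₀)))
  obtain ⟨a, ha, b, hb, hosc, -⟩ := key i
  refine ⟨(a, b), hUV ⟨ha, hb⟩, ?_⟩
  rw [mem_ofPred_eq, hosc, ← hi, Nat.unpair_pair]
end

section
/- If $2^\kappa = \kappa^+$, $A, B$ are infinite sets with $\{|A|, \mathrm{cf}|A|\} \cap \{\kappa, \kappa^+\} \ne \emptyset$ and $\mathrm{cf}|B| = \kappa^+$, then $A \times B$ can be partitioned into $\kappa^+$ many thick subsets. -/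
open Cardinal Set

/-- A family of at most `κ` sets, each of cardinality at least `κ`, has an injective choice
function. -/
theorem exists_injective_mem_of_mk_le {ι X : Type} {κ : Cardinal} (hι : #ι ≤ κ)
    (P : ι → Set X) (hP : ∀ i, κ ≤ #(P i)) :
    ∃ t : ι → X, Function.Injective t ∧ ∀ i, t i ∈ P i := by
  obtain ⟨_, _, hord⟩ := exists_ord_eq_type_lt ι
  have key (i : ι) (prev : ∀ j, j < i → X) :
      ∃ x ∈ P i, ∀ j (hj : j < i), prev j hj ≠ x := by
    by_contra! h
    have hsub : P i ⊆ range fun j : Iio i ↦ prev j.1 j.2 := fun x hx ↦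
      let ⟨j, hj, hx⟩ := h x hx
      ⟨⟨j, hj⟩, hx⟩
    exact ((hP i).trans ((mk_le_mk_of_subset hsub).trans mk_range_le)).not_gt
      ((mk_Iio_lt i hord).trans_le hι)
  choose next mem_next ne_next using key
  let t : ι → X := wellFounded_lt.fix next
  have t_eq (i) : t i = next i fun j _ ↦ t j := wellFounded_lt.fix_eq next i
  have t_ne {i j} (hji : j < i) : t j ≠ t i := by
    rw [t_eq i]
    exact ne_next i (fun j _ ↦ t j) j hji
  refine ⟨t, fun i j hij ↦ ?_, fun i ↦ t_eq i ▸ mem_next i _⟩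
  rcases lt_trichotomy i j with h | h | h
  · exact absurd hij (t_ne h)
  · exact h
  · exact absurd hij.symm (t_ne h)

/-- An infinite type maps to a type of cardinality its cofinality in such a way that no set of
full cardinality has a small image. -/
theorem exists_map_cof_le_mk_image (A : Type) [Infinite A] :
    ∃ (S : Type) (g : A → S), #S = (#A).ord.cof ∧
      ∀ M : Set A, #M = #A → (#A).ord.cof ≤ #(g '' M) := by
  obtain ⟨_, _, hord⟩ := exists_ord_eq_type_lt A
  have hcof : (#A).ord.cof = Order.cof A := by rw [hord, Ordinal.cof_type]
  obtain ⟨S, hS, hSc⟩ := Order.exists_cof_eq A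
  choose g hgS hg using hS
  refine ⟨S, fun a ↦ ⟨g a, hgS a⟩, hSc.trans hcof.symm, fun M hM ↦ ?_⟩
  rw [hcof, ← mk_image_eq (s := (fun a ↦ (⟨g a, hgS a⟩ : S)) '' M) Subtype.val_injective,
    image_image]
  refine Order.cof_le ?_
  by_contra h
  obtain ⟨x, hx⟩ := not_isCofinal_iff.1 h
  have hsub : M ⊆ Iio x := fun a ha ↦ (hg a).trans_lt (hx _ (mem_image_of_mem _ ha))
  exact ((mk_le_mk_of_subset hsub).trans_lt (mk_Iio_lt x hord)).ne hM

/-- Under `2 ^ κ = κ⁺`, there is a colouring of a product of two sets of cardinality at most `κ⁺`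
and exactly `κ⁺` that realizes all of `κ⁺` colours on every rectangle with sides `κ` and `κ⁺`. -/
theorem exists_coloring_surjOn_rectangles {κ : Cardinal.{0}} (hκ : ℵ₀ ≤ κ)
    (hch : 2 ^ κ = Order.succ κ) {X Y C : Type} (hX : #X ≤ Order.succ κ)
    (hY : #Y = Order.succ κ) (hC : #C = Order.succ κ) :
    ∃ f : X → Y → C, ∀ P : Set X, κ ≤ #P → ∀ N : Set Y, Order.succ κ ≤ #N → ∀ c,
      ∃ x ∈ P, ∃ y ∈ N, f x y = c := by
  have hsucc : ℵ₀ ≤ Order.succ κ := hκ.trans (Order.le_succ κ)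
  obtain ⟨_, _, hord⟩ := exists_ord_eq_type_lt Y
  have : Nonempty C := by
    rw [← mk_ne_zero_iff, hC]
    exact (aleph0_pos.trans_le hsucc).ne'
  have hsets : #{P : Set X // #P = κ} ≤ Order.succ κ :=
    calc #{P : Set X // #P = κ} ≤ #{P : Set X // #P ≤ κ} := mk_subtype_mono fun _ h ↦ h.le
      _ ≤ max #X ℵ₀ ^ κ := mk_bounded_set_le X κ
      _ ≤ (2 ^ κ) ^ κ := power_le_power_right (hch ▸ max_le hX hsucc)
      _ = Order.succ κ := by rw [← power_mul, mul_eq_self hκ, hch]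
  have hpairs : #({P : Set X // #P = κ} × C) ≤ #Y := by
    rw [mk_prod, lift_id, lift_id, hC, hY]
    exact (mul_le_mul_left hsets _).trans (mul_eq_self hsucc).le
  obtain ⟨e⟩ := hpairs
  have hIio (y : Y) : #(Iio y) ≤ κ :=
    Order.lt_succ_iff.1 ((mk_Iio_lt y hord).trans_eq hY)
  have htrans (y : Y) : ∃ t : {p // e p < y} → X, Function.Injective t ∧ ∀ p, t p ∈ p.1.1.1 := by
    refine exists_injective_mem_of_mk_le (κ := κ) ?_ _ fun p ↦ p.1.1.2.ge
    refine le_trans (mk_le_of_injective (f := fun p ↦ (⟨e p.1, p.2⟩ : Iio y)) ?_) (hIio y)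
    exact fun p q h ↦ Subtype.ext (e.injective (congrArg Subtype.val h))
  choose t t_inj t_mem using htrans
  refine ⟨fun x y ↦ Function.extend (t y) (fun p ↦ p.1.2) (fun _ ↦ Classical.arbitrary C) x,
    fun P hP N hN c ↦ ?_⟩
  obtain ⟨Q, hQP, hQ⟩ := le_mk_iff_exists_subset.1 hP
  obtain ⟨y, hyN, hy⟩ : ∃ y ∈ N, e (⟨Q, hQ⟩, c) < y := by
    by_contra! h
    exact (hN.trans (mk_le_mk_of_subset (t := Iic (e (⟨Q, hQ⟩, c))) h)).not_gt
      ((mk_Iic_lt _ hord (hY ▸ hsucc)).trans_eq hY)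
  exact ⟨t y ⟨_, hy⟩, hQP (t_mem y ⟨_, hy⟩), y, hyN, (t_inj y).extend_apply _ _ _⟩

/-- if `2^κ = κ⁺`, `A, B` are infinite sets with
`{|A|, cf|A|} ∩ {κ, κ⁺} ≠ ∅` and `cf|B| = κ⁺`, then `A × B` can be partitioned into
`κ⁺` many thick subsets. -/
theorem stmt14 (κ : Cardinal.{0}) (hκ : ℵ₀ ≤ κ) (hch : 2 ^ κ = Order.succ κ)
    (A B : Type) [Infinite A] [Infinite B]
    (hA : #A = κ ∨ #A = Order.succ κ ∨ (#A).ord.cof = κ ∨ (#A).ord.cof = Order.succ κ)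
    (hB : (#B).ord.cof = Order.succ κ) :
    ∃ E : (Quotient.out (Order.succ κ : Cardinal.{0})) → Set (A × B),
      (⋃ i, E i) = Set.univ ∧ Pairwise (Function.onFun Disjoint E) ∧
      ∀ i, ∀ M : Set A, #M = #A → ∀ N : Set B, #N = #B →
        (E i ∩ M ×ˢ N).Nonempty := by
  obtain ⟨X, g, hX, hg⟩ : ∃ (X : Type) (g : A → X), #X ≤ Order.succ κ ∧
      ∀ M : Set A, #M = #A → κ ≤ #(g '' M) := by
    have hle := Order.le_succ κ
    have of_mk (h : κ ≤ #A) (h' : #A ≤ Order.succ κ) : ∃ (X : Type) (g : A → X),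
        #X ≤ Order.succ κ ∧ ∀ M : Set A, #M = #A → κ ≤ #(g '' M) :=
      ⟨A, id, h', fun M hM ↦ by rwa [image_id, hM]⟩
    have of_cof (h : κ ≤ (#A).ord.cof) (h' : (#A).ord.cof ≤ Order.succ κ) :
        ∃ (X : Type) (g : A → X), #X ≤ Order.succ κ ∧ ∀ M : Set A, #M = #A → κ ≤ #(g '' M) :=
      let ⟨S, g, hS, hg⟩ := exists_map_cof_le_mk_image A
      ⟨S, g, hS.trans_le h', fun M hM ↦ h.trans (hg M hM)⟩
    rcases hA with h | h | h | h
    · exact of_mk h.ge (h.trans_le hle)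
    · exact of_mk (hle.trans_eq h.symm) h.le
    · exact of_cof h.ge (h.trans_le hle)
    · exact of_cof (hle.trans_eq h.symm) h.le
  obtain ⟨Y, h, hY, hh⟩ := exists_map_cof_le_mk_image B
  rw [hB] at hY hh
  obtain ⟨f, hf⟩ := exists_coloring_surjOn_rectangles hκ hch hX hY (mk_out (Order.succ κ))
  refine ⟨fun i ↦ {p | f (g p.1) (h p.2) = i}, ?_, ?_, fun i M hM N hN ↦ ?_⟩
  · exact eq_univ_of_forall fun p ↦ mem_iUnion.2 ⟨_, rfl⟩
  · exact fun i j hij ↦ disjoint_left.2 fun p hi hj ↦ hij (hi.symm.trans hj)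
  · obtain ⟨_, ⟨a, ha, rfl⟩, _, ⟨b, hb, rfl⟩, hab⟩ := hf _ (hg M hM) _ (hh N hN) i
    exact ⟨(a, b), hab, ha, hb⟩
end
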